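/- Let (V,b) and (V',b') be isometric finite-dimensional metric spaces over F (possibly singular). Let E ⊆ V and E' ⊆ V' be subspaces with E ≈ E' and dim(E ∩ V^⊥) = dim(E' ∩ V'^⊥). Then there exists an isometry φ_V : V → V' with φ_V(E) = E'. -/

import Mathlib

open Module

namespace Witt

variable {F V V' : Type*} [Field F] [AddCommGroup V] [Module F V]
  [AddCommGroup V'] [Module F V']

/-- A linear equivalence `φ : E ≃ E'` between subspaces is an isometry if it
preserves the ambient bilinear forms. -/
def IsIsometryOn (B : LinearMap.BilinForm F V) (B' : LinearMap.BilinForm F V')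
    (E : Submodule F V) (E' : Submodule F V') (φ : E ≃ₗ[F] E') : Prop :=
  ∀ u v : E, B' (φ u : V') (φ v : V') = B (u : V) (v : V)

/-- A linear equivalence of the whole spaces which preserves the forms. -/
def IsIsometry (B : LinearMap.BilinForm F V) (B' : LinearMap.BilinForm F V')
    (ψ : V ≃ₗ[F] V') : Prop :=
  ∀ u v : V, B' (ψ u) (ψ v) = B u v

/-- The two metric spaces `(V,B)` and `(V',B')` are isometric. -/
def AreIsometric (B : LinearMap.BilinForm F V) (B' : LinearMap.BilinForm F V') : Prop :=
  ∃ ψ : V ≃ₗ[F] V', IsIsometry B B' ψ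

/-- The subspaces `N ⊆ V` and `N' ⊆ V'` are isometric with respect to the
restrictions of the ambient forms. -/
def SubIsometric (B : LinearMap.BilinForm F V) (B' : LinearMap.BilinForm F V')
    (N : Submodule F V) (N' : Submodule F V') : Prop :=
  ∃ ψ : N ≃ₗ[F] N', IsIsometryOn B B' N N' ψ

/-- A subspace is totally isotropic. -/
def TotIsotropic (B : LinearMap.BilinForm F V) (N : Submodule F V) : Prop :=
  ∀ u ∈ N, ∀ v ∈ N, B u v = 0

end Witt

open Module Witt

namespace Witt

section

variable {F V : Type*} [Field F] [AddCommGroup V] [Module F V]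

theorem mem_orthogonal_top {B : LinearMap.BilinForm F V} {x : V} :
    x ∈ B.orthogonal ⊤ ↔ ∀ v, B v x = 0 := by
  simp [LinearMap.BilinForm.mem_orthogonal_iff]

theorem IsIsometry.apply_mem_orthogonal_top_iff {V' : Type*} [AddCommGroup V'] [Module F V']
    {B : LinearMap.BilinForm F V} {B' : LinearMap.BilinForm F V'} {ψ : V ≃ₗ[F] V'}
    (hψ : IsIsometry B B' ψ) {x : V} : ψ x ∈ B'.orthogonal ⊤ ↔ x ∈ B.orthogonal ⊤ := by
  simp only [mem_orthogonal_top]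
  exact ⟨fun h v => by rw [← hψ, h], fun h v => by rw [← ψ.apply_symm_apply v, hψ, h]⟩

theorem IsIsometry.symm {V' : Type*} [AddCommGroup V'] [Module F V']
    {B : LinearMap.BilinForm F V} {B' : LinearMap.BilinForm F V'} {ψ : V ≃ₗ[F] V'}
    (hψ : IsIsometry B B' ψ) : IsIsometry B' B ψ.symm := fun u v => by
  rw [← hψ, ψ.apply_symm_apply, ψ.apply_symm_apply]

theorem IsIsometry.trans {V' V'' : Type*} [AddCommGroup V'] [Module F V']
    [AddCommGroup V''] [Module F V''] {B : LinearMap.BilinForm F V}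
    {B' : LinearMap.BilinForm F V'} {B'' : LinearMap.BilinForm F V''}
    {ψ : V ≃ₗ[F] V'} {χ : V' ≃ₗ[F] V''} (hψ : IsIsometry B B' ψ) (hχ : IsIsometry B' B'' χ) :
    IsIsometry B B'' (ψ.trans χ) := fun u v => by
  rw [LinearEquiv.trans_apply, LinearEquiv.trans_apply, hχ, hψ]

variable [FiniteDimensional F V] {B : LinearMap.BilinForm F V}

/-- A form-preserving endomorphism that is injective on the radical is an isometry. -/
theorem exists_isometry_of_preserves (T : V →ₗ[F] V) (hT : ∀ u v, B (T u) (T v) = B u v)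
    (h0 : ∀ v ∈ B.orthogonal ⊤, T v = 0 → v = 0) :
    ∃ ψ : V ≃ₗ[F] V, IsIsometry B B ψ ∧ ∀ v, ψ v = T v := by
  have hinj : Function.Injective T := by
    rw [injective_iff_map_eq_zero]
    refine fun v hv => h0 v (mem_orthogonal_top.2 fun u => ?_) hv
    rw [← hT, hv, map_zero]
  exact ⟨LinearEquiv.ofInjectiveEndo T hinj, hT, fun _ => rfl⟩

/-- A vector outside `K + V^⊥` is not orthogonal to all of `K^⊥`. -/
theorem exists_orthogonal_apply_eq_one (hB : ∀ u v, B u v = B v u) {K : Submodule F V} {x : V}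
    (hx : x ∉ K ⊔ B.orthogonal ⊤) : ∃ w, (∀ k ∈ K, B k w = 0) ∧ B x w = 1 := by
  have hr : B.IsRefl := fun u v h => by rw [hB, h]
  have hle : K ⊔ B.orthogonal ⊤ ≤ B.orthogonal (B.orthogonal K) :=
    sup_le (LinearMap.BilinForm.le_orthogonal_orthogonal hr)
      (LinearMap.BilinForm.orthogonal_le le_top)
  have heq : K ⊔ B.orthogonal ⊤ = B.orthogonal (B.orthogonal K) := by
    apply Submodule.eq_of_le_of_finrank_eq hle
    have h1 := LinearMap.BilinForm.finrank_add_finrank_orthogonal hr K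
    have h2 := LinearMap.BilinForm.finrank_add_finrank_orthogonal hr (B.orthogonal K)
    have h3 := Submodule.finrank_sup_add_finrank_inf_eq K (B.orthogonal ⊤)
    rw [inf_eq_right.2 (LinearMap.BilinForm.orthogonal_le le_top)] at h2
    omega
  rw [heq, LinearMap.BilinForm.mem_orthogonal_iff] at hx
  push Not at hx
  obtain ⟨w, hw, hwx⟩ := hx
  rw [hB] at hwx
  refine ⟨(B x w)⁻¹ • w, fun k hk => ?_, by simp [hwx]⟩
  rw [map_smul, LinearMap.BilinForm.mem_orthogonal_iff.1 hw k hk, smul_zero]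

/-- The transvection case of Witt's extension theorem. -/
theorem exists_isometry_of_sub_mem_radical (hB : ∀ u v, B u v = B v u) {H : Submodule F V}
    {x y : V} (hx : x ∉ H) (hy : y ∉ H) (hz : y - x ∈ B.orthogonal ⊤) :
    ∃ ψ : V ≃ₗ[F] V, IsIsometry B B ψ ∧ (∀ h ∈ H, ψ h = h) ∧ ψ x = y := by
  obtain ⟨f, hfH, hfx, hfy⟩ : ∃ f : V →ₗ[F] F, (∀ h ∈ H, f h = 0) ∧ f x = 1 ∧ f y ≠ 0 := by
    suffices ∃ f : V →ₗ[F] F, (∀ h ∈ H, f h = 0) ∧ f x ≠ 0 ∧ f y ≠ 0 by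
      obtain ⟨f, h1, h2, h3⟩ := this
      exact ⟨(f x)⁻¹ • f, fun h hh => by simp [h1 h hh], by simp [h2], by simp [h2, h3]⟩
    obtain ⟨f, hf, hfH⟩ := Submodule.exists_le_ker_of_notMem hx
    obtain ⟨g, hg, hgH⟩ := Submodule.exists_le_ker_of_notMem hy
    by_cases hfy : f y = 0
    · by_cases hgx : g x = 0
      · exact ⟨f + g, fun h hh => by
          simp [LinearMap.mem_ker.1 (hfH hh), LinearMap.mem_ker.1 (hgH hh)],
          by simpa [hgx] using hf, by simpa [hfy] using hg⟩
      · exact ⟨g, fun h hh => hgH hh, hgx, hg⟩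
    · exact ⟨f, fun h hh => hfH hh, hf, hfy⟩
  have hz' := mem_orthogonal_top.1 hz
  have hz'' : ∀ v, B (y - x) v = 0 := fun v => by rw [hB, hz']
  obtain ⟨ψ, hψ, hψT⟩ := exists_isometry_of_preserves (B := B)
    (LinearMap.id + f.smulRight (y - x))
    (fun u v => by
      simp only [LinearMap.add_apply, LinearMap.id_apply, LinearMap.smulRight_apply, map_add,
        map_smul, LinearMap.smul_apply, hz', hz'', smul_zero, add_zero])
    (fun v _ hv => by
      simp only [LinearMap.add_apply, LinearMap.id_apply, LinearMap.smulRight_apply] at hv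
      have h := congrArg f hv
      have hfv : f v = 0 := by
        simp only [map_add, map_smul, map_sub, hfx, smul_eq_mul, map_zero] at h
        refine (mul_eq_zero.1 (?_ : f v * f y = 0)).resolve_right hfy
        linear_combination h
      simpa [hfv] using hv)
  refine ⟨ψ, hψ, fun h hh => ?_, ?_⟩
  · simp [hψT, hfH h hh]
  · simp [hψT, hfx]

/-- The reflection case of Witt's extension theorem. -/
theorem exists_isometry_of_anisotropic_sub (hB : ∀ u v, B u v = B v u) {H : Submodule F V}
    {x y : V} (hH : ∀ h ∈ H, B (y - x) h = 0) (hxy : B x x = B y y)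
    (hz : B (y - x) (y - x) ≠ 0) :
    ∃ ψ : V ≃ₗ[F] V, IsIsometry B B ψ ∧ (∀ h ∈ H, ψ h = h) ∧ ψ x = y := by
  obtain ⟨z, rfl⟩ : ∃ z, y = x + z := ⟨y - x, by abel⟩
  simp only [add_sub_cancel_left] at *
  obtain ⟨c, hc⟩ : ∃ c, c * B z z = 2 := ⟨2 / B z z, div_mul_cancel₀ _ hz⟩
  obtain ⟨ψ, hψ, hψT⟩ := exists_isometry_of_preserves (B := B)
    (LinearMap.id - c • (B z).smulRight z)
    (fun u v => by
      simp only [LinearMap.sub_apply, LinearMap.id_apply, LinearMap.smulRight_apply, map_sub,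
        map_smul, LinearMap.smul_apply, smul_eq_mul, hB u z]
      linear_combination c * B z u * B z v * hc)
    (fun v hv hv0 => by
      simpa [mem_orthogonal_top.1 hv z] using hv0)
  refine ⟨ψ, hψ, fun h hh => ?_, ?_⟩
  · simp [hψT, hH h hh]
  · have h1 : c * B z x = -1 := by
      simp only [map_add, LinearMap.add_apply, hB x z] at hxy
      have : (c * B z x + 1) * B z z = 0 := by
        linear_combination B z x * hc - hxy
      rcases mul_eq_zero.1 this with h | h
      · linear_combination h
      · exact absurd h hz
    simp [hψT, smul_smul, h1]

/-- The Siegel–Eichler case of Witt's extension theorem. -/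
theorem exists_isometry_of_isotropic_sub (hchar : (2 : F) ≠ 0) (hB : ∀ u v, B u v = B v u)
    {H : Submodule F V} {x z : V} (hH : ∀ h ∈ H, B z h = 0) (hzx : B z x = 0) (hz : B z z = 0)
    (hx : x ∉ (H ⊔ F ∙ z) ⊔ B.orthogonal ⊤) :
    ∃ ψ : V ≃ₗ[F] V, IsIsometry B B ψ ∧ (∀ h ∈ H, ψ h = h) ∧ ψ x = x + z := by
  obtain ⟨w, hw, hxw⟩ := exists_orthogonal_apply_eq_one hB hx
  have hHw : ∀ h ∈ H, B w h = 0 := fun h hh => by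
    rw [hB, hw h (Submodule.mem_sup_left hh)]
  have hzw : B z w = 0 := hw z (Submodule.mem_sup_right (Submodule.mem_span_singleton_self z))
  have hwz : B w z = 0 := by rw [hB, hzw]
  have hwx : B w x = 1 := by rw [hB, hxw]
  obtain ⟨c, hc⟩ : ∃ c, c * 2 = B w w := ⟨B w w / 2, div_mul_cancel₀ _ hchar⟩
  obtain ⟨ψ, hψ, hψT⟩ := exists_isometry_of_preserves (B := B)
    (LinearMap.id + (B w).smulRight z - (B z).smulRight w - c • (B z).smulRight z)
    (fun u v => by
      simp only [LinearMap.sub_apply, LinearMap.add_apply, LinearMap.id_apply,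
        LinearMap.smulRight_apply, map_sub, map_add,
        map_smul, LinearMap.smul_apply, smul_eq_mul, hB u z, hB u w, hz, hzw, hwz]
      linear_combination -B z u * B z v * hc)
    (fun v hv hv0 => by
      simpa [mem_orthogonal_top.1 hv] using hv0)
  refine ⟨ψ, hψ, fun h hh => ?_, ?_⟩
  · simp [hψT, hH h hh, hHw h hh]
  · simp [hψT, hwx, hzx]

/-- Scaling one isotropic line orthogonal to `H`, fixing `H` pointwise. -/
theorem exists_isometry_smul (hchar : (2 : F) ≠ 0) (hB : ∀ u v, B u v = B v u)
    {H : Submodule F V} {x : V} (hH : ∀ h ∈ H, B x h = 0) (hxx : B x x = 0)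
    (hx : x ∉ H ⊔ B.orthogonal ⊤) {a : F} (ha : a ≠ 0) :
    ∃ ψ : V ≃ₗ[F] V, IsIsometry B B ψ ∧ (∀ h ∈ H, ψ h = h) ∧ ψ x = a • x := by
  obtain ⟨w, hHw, hxw, hww⟩ : ∃ w, (∀ h ∈ H, B w h = 0) ∧ B x w = 1 ∧ B w w = 0 := by
    obtain ⟨w, hw, hxw⟩ := exists_orthogonal_apply_eq_one hB hx
    have hwx : B w x = 1 := by rw [hB, hxw]
    refine ⟨w - (B w w / 2) • x, fun h hh => ?_, ?_, ?_⟩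
    · simp [hH h hh, hB w h, hw h hh]
    · simp [hxx, hxw]
    · simp only [map_sub, map_smul, LinearMap.sub_apply, LinearMap.smul_apply, smul_eq_mul, hxx,
        hxw, hwx]
      field_simp
      ring
  have hwx : B w x = 1 := by rw [hB, hxw]
  obtain ⟨ψ, hψ, hψT⟩ := exists_isometry_of_preserves (B := B)
    (LinearMap.id + (a - 1) • (B w).smulRight x + (a⁻¹ - 1) • (B x).smulRight w)
    (fun u v => by
      simp only [LinearMap.add_apply, LinearMap.id_apply,
        LinearMap.smulRight_apply, map_add,
        map_smul, LinearMap.smul_apply, smul_eq_mul, hB u x, hB u w, hxx, hxw, hwx, hww]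
      field_simp
      ring)
    (fun v hv hv0 => by
      simpa [mem_orthogonal_top.1 hv] using hv0)
  refine ⟨ψ, hψ, fun h hh => ?_, ?_⟩
  · simp [hψT, hH h hh, hHw h hh]
  · simp [hψT, hwx, hxx, sub_smul]

/-- One-vector step of Witt's extension theorem: an isometry which fixes `H` pointwise. -/
theorem exists_isometry_fixing (hchar : (2 : F) ≠ 0) (hB : ∀ u v, B u v = B v u)
    {H : Submodule F V} {x y : V} (hx : x ∉ H) (hy : y ∉ H)
    (hH : ∀ h ∈ H, B (y - x) h = 0) (hxy : B x x = B y y)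
    (hR : ∀ h ∈ H, y - h ∈ B.orthogonal ⊤ ↔ x - h ∈ B.orthogonal ⊤) :
    ∃ ψ : V ≃ₗ[F] V, IsIsometry B B ψ ∧ (∀ h ∈ H, ψ h = h) ∧ ψ x = y := by
  by_cases hzR : y - x ∈ B.orthogonal ⊤
  · exact exists_isometry_of_sub_mem_radical hB hx hy hzR
  by_cases hzz : B (y - x) (y - x) = 0
  swap
  · exact exists_isometry_of_anisotropic_sub hB hH hxy hzz
  have hxHR : x ∉ H ⊔ B.orthogonal ⊤ := by
    intro h
    obtain ⟨k, hk, r, hr, rfl⟩ := Submodule.mem_sup.1 h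
    have h1 : k + r - k ∈ B.orthogonal ⊤ := by simpa using hr
    have h2 := sub_mem ((hR k hk).2 h1) h1
    rw [sub_sub_sub_cancel_right] at h2
    exact hzR h2
  obtain ⟨z, rfl⟩ : ∃ z, y = x + z := ⟨y - x, by abel⟩
  simp only [add_sub_cancel_left] at hzz hzR hH
  have hzx : B z x = 0 := by
    simp only [map_add, LinearMap.add_apply, hB x z, hzz] at hxy
    refine (mul_eq_zero.1 (?_ : 2 * B z x = 0)).resolve_left hchar
    linear_combination -hxy
  by_cases hx' : x ∈ (H ⊔ F ∙ z) ⊔ B.orthogonal ⊤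
  swap
  · exact exists_isometry_of_isotropic_sub hchar hB hH hzx hzz hx'
  obtain ⟨k', hk', r, hr, rfl⟩ := Submodule.mem_sup.1 hx'
  obtain ⟨k, hk, z', hz', rfl⟩ := Submodule.mem_sup.1 hk'
  obtain ⟨a, rfl⟩ := Submodule.mem_span_singleton.1 hz'
  have hr1 := mem_orthogonal_top.1 hr
  have hr2 : ∀ v, B r v = 0 := fun v => by rw [hB, hr1]
  have ha : a ≠ 0 := by
    rintro rfl
    exact hxHR (by simpa using Submodule.add_mem_sup hk hr)
  have ha1 : 1 + a⁻¹ ≠ 0 := by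
    intro h
    have ha' : a = -1 := by
      field_simp at h
      linear_combination h
    subst ha'
    have := (hR k hk).1 (by convert hr using 1; module)
    apply hzR
    convert sub_mem hr this using 1
    module
  have hmem : a • z + r ∉ H ⊔ B.orthogonal ⊤ := fun h => hxHR (by
    rw [add_assoc]
    exact add_mem (Submodule.mem_sup_left hk) h)
  obtain ⟨ρ, hρ, hρH, hρx⟩ := exists_isometry_smul hchar hB (H := H) (x := a • z + r)
    (fun h hh => by simp [hH h hh, hr2]) (by simp [hzz, hr1, hr2]) hmem ha1
  have hρx' : ρ (k + a • z + r) = k + (1 + a⁻¹) • (a • z + r) := by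
    rw [add_assoc, map_add, hρH k hk, hρx]
  have hdiff : k + a • z + r + z - ρ (k + a • z + r) = -a⁻¹ • r := by
    rw [hρx', smul_add, smul_smul, add_mul, inv_mul_cancel₀ ha]
    module
  obtain ⟨τ, hτ, hτH, hτx⟩ := exists_isometry_of_sub_mem_radical hB (H := H)
    (x := ρ (k + a • z + r)) (y := k + a • z + r + z)
    (fun h => hx (by
      have := hρH _ h
      rwa [← ρ.injective this])) hy
    (by rw [hdiff]; exact Submodule.smul_mem _ _ hr)
  exact ⟨ρ.trans τ, hρ.trans hτ, fun h hh => by simp [hρH h hh, hτH h hh], by simpa using hτx⟩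

/-- **Witt's extension theorem** for possibly singular spaces: an injective isometry defined on
`E` extends to the whole space as soon as it respects membership in the radical. -/
theorem exists_isometry_extending (hchar : (2 : F) ≠ 0) (hB : ∀ u v, B u v = B v u)
    {E : Submodule F V} (σ : E →ₗ[F] V) (hσ : ∀ u v : E, B (σ u) (σ v) = B u v)
    (hinj : Function.Injective σ)
    (hR : ∀ u : E, σ u ∈ B.orthogonal ⊤ ↔ (u : V) ∈ B.orthogonal ⊤) :
    ∃ ψ : V ≃ₗ[F] V, IsIsometry B B ψ ∧ ∀ u : E, ψ u = σ u := by
  obtain ⟨τ, hτ⟩ := σ.exists_extend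
  have hτσ : ∀ u : E, τ u = σ u := fun u => by rw [← hτ]; rfl
  suffices ∀ s : Set V, s.Finite → Submodule.span F s ≤ E →
      ∃ ψ : V ≃ₗ[F] V, IsIsometry B B ψ ∧ ∀ u ∈ Submodule.span F s, ψ u = τ u by
    obtain ⟨s, hs⟩ := IsNoetherian.noetherian E
    obtain ⟨ψ, hψ, h⟩ := this s s.finite_toSet hs.le
    exact ⟨ψ, hψ, fun u => by rw [h u (hs ▸ u.2), hτσ]⟩
  have hτB : ∀ u ∈ E, ∀ v ∈ E, B (τ u) (τ v) = B u v := fun u hu v hv => by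
    simpa [← hτσ] using hσ ⟨u, hu⟩ ⟨v, hv⟩
  have hτR : ∀ u ∈ E, τ u ∈ B.orthogonal ⊤ ↔ u ∈ B.orthogonal ⊤ := fun u hu => by
    simpa [← hτσ] using hR ⟨u, hu⟩
  have hτinj : ∀ u ∈ E, ∀ v ∈ E, τ u = τ v → u = v := fun u hu v hv h => by
    have := @hinj ⟨u, hu⟩ ⟨v, hv⟩ (by simpa [← hτσ] using h)
    simpa using this
  intro s hs
  induction s, hs using Set.Finite.induction_on with
  | empty =>
    refine fun _ => ⟨LinearEquiv.refl F V, fun _ _ => rfl, fun u hu => ?_⟩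
    rw [Submodule.span_empty, Submodule.mem_bot] at hu
    simp [hu]
  | @insert x s _ _ ih =>
    intro hE
    have hsE : Submodule.span F s ≤ E :=
      (Submodule.span_mono (Set.subset_insert x s)).trans hE
    have hxE : x ∈ E := hE (Submodule.subset_span (Set.mem_insert x s))
    obtain ⟨ψ, hψ, hψs⟩ := ih hsE
    by_cases hx : x ∈ Submodule.span F s
    · refine ⟨ψ, hψ, ?_⟩
      rwa [Submodule.span_insert_eq_span hx]
    have hy : ∀ h ∈ Submodule.span F s, h = ψ.symm (τ h) := fun h hh => by
      rw [← hψs h hh, ψ.symm_apply_apply]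
    obtain ⟨ρ, hρ, hρs, hρx⟩ := exists_isometry_fixing hchar hB (H := Submodule.span F s)
      (x := x) (y := ψ.symm (τ x)) hx
      (fun h => hx (by
        have h1 := ψ.symm.injective (hy _ h)
        rwa [← hτinj x hxE _ (hsE h) h1] at h))
      (fun h hh => by
        rw [map_sub, LinearMap.sub_apply, sub_eq_zero]
        conv_lhs => rw [hy h hh, hψ.symm, hτB x hxE h (hsE hh)])
      (by rw [hψ.symm, hτB x hxE x hxE])
      (fun h hh => by
        rw [← hτR (x - h) (sub_mem hxE (hsE hh)), ← hψ.symm.apply_mem_orthogonal_top_iff (x := τ (x - h)),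
          map_sub τ, map_sub ψ.symm, ← hy h hh])
    refine ⟨ρ.trans ψ, hρ.trans hψ, fun u hu => ?_⟩
    obtain ⟨a, h, hh, rfl⟩ := Submodule.mem_span_insert.1 hu
    simp [hρx, hρs h hh, hψs h hh]

/-- Subspaces of the radical of the same dimension are interchanged by an isometry. -/
theorem exists_isometry_map_eq_of_le_radical (hchar : (2 : F) ≠ 0) (hB : ∀ u v, B u v = B v u)
    {P Q : Submodule F V} (hP : P ≤ B.orthogonal ⊤) (hQ : Q ≤ B.orthogonal ⊤)
    (h : finrank F P = finrank F Q) :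
    ∃ ψ : V ≃ₗ[F] V, IsIsometry B B ψ ∧ ∀ v, ψ v ∈ Q ↔ v ∈ P := by
  let e : P ≃ₗ[F] Q := LinearEquiv.ofFinrankEq P Q h
  obtain ⟨ψ, hψ, hψe⟩ := exists_isometry_extending hchar hB (Q.subtype ∘ₗ e.toLinearMap)
    (fun u v => by
      rw [mem_orthogonal_top.1 (hP v.2)]
      exact mem_orthogonal_top.1 (hQ (e v).2) _)
    (Q.injective_subtype.comp e.injective)
    (fun u => iff_of_true (hQ (e u).2) (hP u.2))
  refine ⟨ψ, hψ, fun v => ⟨fun hv => ?_, fun hv => ?_⟩⟩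
  · have h1 : ψ (e.symm ⟨ψ v, hv⟩ : P) = ψ v := by simp [hψe]
    rw [← ψ.injective h1]
    exact Subtype.coe_prop _
  · rw [hψe ⟨v, hv⟩]
    exact (e ⟨v, hv⟩).2

end

end Witt

/-- Lemma 2.4: if `E ≈ E'` and `dim(E ∩ V^⊥) = dim(E' ∩ V'^⊥)`, then there is
an isometry `φ_V : V → V'` with `φ_V(E) = E'`. -/
theorem witt_exists_isometry_sending_subspace {F V V' : Type*} [Field F]
    [AddCommGroup V] [Module F V] [AddCommGroup V'] [Module F V']
    [FiniteDimensional F V] [FiniteDimensional F V']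
    (hchar : (2 : F) ≠ 0)
    (B : LinearMap.BilinForm F V) (B' : LinearMap.BilinForm F V')
    (hB : ∀ u v : V, B u v = B v u) (hB' : ∀ u v : V', B' u v = B' v u)
    (hVV' : AreIsometric B B')
    (E : Submodule F V) (E' : Submodule F V')
    (hEE' : SubIsometric B B' E E')
    (hdim : finrank F ↥(E ⊓ B.orthogonal ⊤) = finrank F ↥(E' ⊓ B'.orthogonal ⊤)) :
    ∃ φV : V ≃ₗ[F] V', IsIsometry B B' φV ∧ E.map φV.toLinearMap = E' := by
  obtain ⟨ψ, hψ⟩ := hVV'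
  obtain ⟨φ, hφ⟩ := hEE'
  have hrad : ∀ w : E', (w : V') ∈ B'.orthogonal ⊤ → w ∈ (B'.restrict E').orthogonal ⊤ :=
    fun w hw => mem_orthogonal_top.2 fun v => mem_orthogonal_top.1 hw v
  have hrad' : ∀ u : E, (u : V) ∈ B.orthogonal ⊤ → φ u ∈ (B'.restrict E').orthogonal ⊤ :=
    fun u hu => mem_orthogonal_top.2 fun v => by
      obtain ⟨v, rfl⟩ := φ.surjective v
      exact (hφ v u).trans (mem_orthogonal_top.1 hu v)
  obtain ⟨α, hα, hαR⟩ := exists_isometry_map_eq_of_le_radical hchar (B := B'.restrict E')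
    (fun u v => hB' u v)
    (P := ((B.orthogonal ⊤).comap E.subtype).map φ.toLinearMap)
    (Q := (B'.orthogonal ⊤).comap E'.subtype)
    (by rintro _ ⟨u, hu, rfl⟩; exact hrad' u hu) (fun w hw => hrad w hw)
    (by
      have h1 := LinearEquiv.finrank_map_eq φ ((B.orthogonal ⊤).comap E.subtype)
      have h2 := (Submodule.finrank_map_subtype_eq E ((B.orthogonal ⊤).comap E.subtype))
      have h3 := (Submodule.finrank_map_subtype_eq E' ((B'.orthogonal ⊤).comap E'.subtype))
      rw [Submodule.map_comap_subtype] at h2 h3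
      exact h1.trans (h2.symm.trans (hdim.trans h3)))
  obtain ⟨χ, hχ, hχσ⟩ := exists_isometry_extending hchar hB
    (ψ.symm.toLinearMap ∘ₗ E'.subtype ∘ₗ (φ.trans α).toLinearMap)
    (fun u v => (hψ.symm _ _).trans ((hα _ _).trans (hφ u v)))
    (ψ.symm.injective.comp (E'.injective_subtype.comp (φ.trans α).injective))
    (fun u => (hψ.symm.apply_mem_orthogonal_top_iff).trans ((hαR (φ u)).trans (by simp)))
  have hE : ∀ u : E, χ.trans ψ u = α (φ u) := fun u => by simp [hχσ]
  refine ⟨χ.trans ψ, hχ.trans hψ, le_antisymm ?_ fun w hw => ?_⟩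
  · rintro _ ⟨u, hu, rfl⟩
    exact (hE ⟨u, hu⟩).symm ▸ Subtype.coe_prop _
  · refine ⟨φ.symm (α.symm ⟨w, hw⟩), Subtype.coe_prop _, ?_⟩
    exact (hE _).trans (by simp)
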